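/- Let γ : [0,∞)×Ω̄ → ℝ^d be a smooth solution of the homogeneous wave system γ_tt − μΔγ = 0 in (0,∞)×Ω with boundary conditions γ·n = 0 and 𝒩γ = 0 on (0,∞)×∂Ω. Then ‖γ(t,·)‖_{L²(Ω)} → 0 as t → ∞ if and only if γ is identically zero. -/

import Mathlib

open MeasureTheory Real Filter Set
open scoped Topology

noncomputable section

/-- Euclidean space `ℝ^d`. -/
abbrev Ed (d : ℕ) := EuclideanSpace ℝ (Fin d)

/-- Partial derivative of a scalar function in the `i`-th coordinate direction. -/
def pd {d : ℕ} (i : Fin d) (f : Ed d → ℝ) (x : Ed d) : ℝ :=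
  fderiv ℝ f x (EuclideanSpace.single i 1)

/-- Divergence of a vector field. -/
def divg {d : ℕ} (w : Ed d → Ed d) (x : Ed d) : ℝ :=
  ∑ i, pd i (fun y => w y i) x

/-- Laplacian of a scalar function. -/
def lap {d : ℕ} (f : Ed d → ℝ) (x : Ed d) : ℝ :=
  ∑ i, pd i (fun y => pd i f y) x

/-- Squared euclidean norm of the gradient of a scalar function. -/
def gradNormSq {d : ℕ} (f : Ed d → ℝ) (x : Ed d) : ℝ :=
  ∑ i, (pd i f x) ^ 2

/-- Squared Frobenius norm of the Hessian of a scalar function. -/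
def hessNormSq {d : ℕ} (f : Ed d → ℝ) (x : Ed d) : ℝ :=
  ∑ i, ∑ j, (pd i (fun y => pd j f y) x) ^ 2

/-- The antisymmetric curl two-form `(curl w)ᵢⱼ = ∂ᵢ wⱼ - ∂ⱼ wᵢ`. -/
def curlM {d : ℕ} (w : Ed d → Ed d) (x : Ed d) (i j : Fin d) : ℝ :=
  pd i (fun y => w y j) x - pd j (fun y => w y i) x

/-- `|curl w|²`: in dimension 2 (scalar curl) and 3 (vector curl) this equals
the squared norm of the curl. -/
def curlNormSq {d : ℕ} (w : Ed d → Ed d) (x : Ed d) : ℝ :=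
  (1 / 2) * ∑ i, ∑ j, (curlM w x i j) ^ 2

/-- `j`-th component of `curl curl w` (in dimensions 2 and 3 this is
`∑ i ∂ᵢ (∂ⱼ wᵢ - ∂ᵢ wⱼ) = ∂ⱼ (div w) - Δ wⱼ`). -/
def ccurl {d : ℕ} (w : Ed d → Ed d) (x : Ed d) (j : Fin d) : ℝ :=
  ∑ i, pd i (fun y => curlM w y j i) x

/-- `j`-th component of the componentwise Laplacian of a vector field. -/
def veclap {d : ℕ} (w : Ed d → Ed d) (x : Ed d) (j : Fin d) : ℝ :=
  ∑ i, pd i (fun y => pd i (fun z => w z j) y) x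

/-- Time derivative of a time-dependent field. -/
def tder {α : Type*} {F : Type*} [NormedAddCommGroup F] [NormedSpace ℝ F]
    (u : ℝ → α → F) : ℝ → α → F :=
  fun t x => deriv (fun s => u s x) t

/-- An open, bounded, convex domain in `ℝ^d` (`d ∈ {2,3}`) together with its outward
unit normal field `n` on the boundary.  For a convex body with smooth boundary the
outward unit normal at a boundary point is characterized by the supporting
half-space inequality. -/
structure GoodDomain (d : ℕ) (Ω : Set (Ed d)) (n : Ed d → Ed d) : Prop where
  dims : d = 2 ∨ d = 3
  isOpen : IsOpen Ω
  bounded : Bornology.IsBounded Ω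
  convex : Convex ℝ Ω
  nonempty : Ω.Nonempty
  normal_unit : ∀ x ∈ frontier Ω, ‖n x‖ = 1
  normal_outward : ∀ x ∈ frontier Ω, ∀ y ∈ closure Ω, ∑ i, (y i - x i) * n x i ≤ 0

/-- A smooth solution `(u, θ)` of the thermoelastic system
`u_tt - (2μ+λ)∇(div u) + μ curl curl u = -ν∇θ`, `θ_t - Δθ = -ν θ div u_t`
with boundary conditions `u·n = 0`, `𝒩u = 0` (encoded as `(curl u) n = 0`,
which in dimension 2 means `curl u = 0` and in dimension 3 means
`curl u × n = 0`) and `∇θ·n = 0`, and with positive temperature. -/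
structure IsSolution {d : ℕ} (Ω : Set (Ed d)) (n : Ed d → Ed d)
    (μ lam ν : ℝ) (u : ℝ → Ed d → Ed d) (θ : ℝ → Ed d → ℝ) : Prop where
  smooth_u : ContDiff ℝ (⊤ : ℕ∞) (fun p : ℝ × Ed d => u p.1 p.2)
  smooth_θ : ContDiff ℝ (⊤ : ℕ∞) (fun p : ℝ × Ed d => θ p.1 p.2)
  theta_pos : ∀ t : ℝ, 0 ≤ t → ∀ x ∈ closure Ω, 0 < θ t x
  wave : ∀ t : ℝ, 0 < t → ∀ x ∈ Ω, ∀ j : Fin d,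
    tder (tder u) t x j - (2 * μ + lam) * pd j (divg (u t)) x
      + μ * ccurl (u t) x j = -ν * pd j (θ t) x
  heat : ∀ t : ℝ, 0 < t → ∀ x ∈ Ω,
    tder θ t x - lap (θ t) x = -ν * θ t x * divg (tder u t) x
  bc_u : ∀ t : ℝ, 0 < t → ∀ x ∈ frontier Ω, ∑ i, u t x i * n x i = 0
  bc_N : ∀ t : ℝ, 0 < t → ∀ x ∈ frontier Ω, ∀ i : Fin d,
    ∑ j, curlM (u t) x i j * n x j = 0
  bc_θ : ∀ t : ℝ, 0 < t → ∀ x ∈ frontier Ω, ∑ i, pd i (θ t) x * n x i = 0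

/-- The functional `F(u, u_t, θ)` built from the Fisher information and
higher-order derivatives of the displacement. -/
def Ffun {d : ℕ} (Ω : Set (Ed d)) (μ lam : ℝ)
    (u : ℝ → Ed d → Ed d) (θ : ℝ → Ed d → ℝ) (t : ℝ) : ℝ :=
  (1 / 2) * ((∫ x in Ω, (divg (tder u t) x) ^ 2)
    + (∫ x in Ω, curlNormSq (tder u t) x)
    + (2 * μ + lam) * (∫ x in Ω, gradNormSq (divg (u t)) x)
    + μ * (∫ x in Ω, ∑ j, (ccurl (u t) x j) ^ 2)
    + (∫ x in Ω, gradNormSq (θ t) x / θ t x))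

/-- The small-data condition
`‖div v₀‖² + ‖curl v₀‖² + (2μ+λ)‖∇div u₀‖² + μ‖curl curl u₀‖² + ‖∇θ₀/√θ₀‖² ≤ D`. -/
def smallData {d : ℕ} (Ω : Set (Ed d)) (μ lam : ℝ)
    (u0 v0 : Ed d → Ed d) (θ0 : Ed d → ℝ) (D : ℝ) : Prop :=
  (∫ x in Ω, (divg v0 x) ^ 2) + (∫ x in Ω, curlNormSq v0 x)
    + (2 * μ + lam) * (∫ x in Ω, gradNormSq (divg u0) x)
    + μ * (∫ x in Ω, ∑ j, (ccurl u0 x j) ^ 2)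
    + (∫ x in Ω, gradNormSq θ0 x / θ0 x) ≤ D

/-- The norm `‖w‖_H = (‖div w‖² + ‖curl w‖²)^{1/2}`. -/
def Hnorm {d : ℕ} (Ω : Set (Ed d)) (w : Ed d → Ed d) : ℝ :=
  Real.sqrt ((∫ x in Ω, (divg w x) ^ 2) + (∫ x in Ω, curlNormSq w x))

end

section InnerDistance

variable {E : Type*} [NormedAddCommGroup E] [InnerProductSpace ℝ E]

/-- The distance from a point of an open set to the complement is at most the distance to any
supporting hyperplane. -/
theorem infDist_compl_le_inner_of_supporting {Ω : Set E} (hΩ : IsOpen Ω) {y m z : E}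
    (hm : ‖m‖ = 1) (hsupp : ∀ p ∈ closure Ω, inner ℝ (p - y) m ≤ 0) (hz : z ∈ Ω) :
    Metric.infDist z Ωᶜ ≤ inner ℝ (y - z) m := by
  set s : ℝ := inner ℝ (y - z) m with hs
  have hs0 : 0 ≤ s := by
    have h := hsupp z (subset_closure hz)
    rw [← neg_sub, inner_neg_left] at h
    linarith
  have hmm : inner ℝ m m = (1 : ℝ) := by rw [real_inner_self_eq_norm_sq, hm]; norm_num
  have hp : z + s • m ∈ Ωᶜ := by
    intro hp
    have hcont : ContinuousAt (fun t : ℝ => z + s • m + t • m) 0 := by fun_prop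
    have hev : ∀ᶠ t : ℝ in 𝓝 0, z + s • m + t • m ∈ Ω :=
      hcont.eventually_mem (hΩ.mem_nhds (by simpa using hp))
    obtain ⟨t, ht, ht0⟩ := ((hev.filter_mono nhdsWithin_le_nhds).and
      (self_mem_nhdsWithin : Ioi (0 : ℝ) ∈ 𝓝[>] 0)).exists
    have h := hsupp _ (subset_closure ht)
    have hexp : z + s • m + t • m - y = -(y - z) + (s + t) • m := by
      rw [add_smul]; abel
    rw [hexp, inner_add_left, inner_neg_left, real_inner_smul_left, hmm, ← hs] at h
    have : (0 : ℝ) < t := ht0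
    linarith
  calc Metric.infDist z Ωᶜ ≤ dist z (z + s • m) := Metric.infDist_le_dist_of_mem hp
    _ = s := by rw [dist_self_add_right, norm_smul, hm, mul_one, Real.norm_of_nonneg hs0]

/-- The truncated distance to the complement of an open set has a small derivative along a
Lipschitz vector field that is tangent to the boundary. -/
theorem abs_lineDeriv_min_infDist_compl_le [FiniteDimensional ℝ E] {Ω : Set E} (hΩ : IsOpen Ω)
    (hne : Ω ≠ univ) {n X : E → E} (hn : ∀ y ∈ frontier Ω, ‖n y‖ = 1)
    (hsupp : ∀ y ∈ frontier Ω, ∀ p ∈ closure Ω, inner ℝ (p - y) (n y) ≤ 0)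
    {L : NNReal} (hX : LipschitzWith L X) (htan : ∀ y ∈ frontier Ω, inner ℝ (X y) (n y) = 0)
    {ε : ℝ} (x : E) :
    |lineDeriv ℝ (fun z => min ε (Metric.infDist z Ωᶜ)) x (X x)| ≤
      {z | z ∈ Ω ∧ Metric.infDist z Ωᶜ < ε}.indicator (fun _ => L * ε) x := by
  set δ : E → ℝ := fun z => Metric.infDist z Ωᶜ
  have hδc : Continuous δ := Metric.continuous_infDist_pt _
  have hline : ContinuousAt (fun t : ℝ => x + t • X x) 0 := by fun_prop
  unfold lineDeriv
  by_cases hx : x ∈ {z | z ∈ Ω ∧ δ z < ε}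
  · rw [indicator_of_mem hx]
    obtain ⟨hxΩ, hxε⟩ := hx
    obtain ⟨y, hy, hyd⟩ := exists_mem_frontier_infDist_compl_eq_dist hxΩ hne
    have hle := fun {z : E} (hz : z ∈ Ω) =>
      infDist_compl_le_inner_of_supporting hΩ (hn y hy) (hsupp y hy) hz
    have hinner : |inner ℝ (X x) (n y)| ≤ L * ε := by
      calc |inner ℝ (X x) (n y)| = |inner ℝ (X x - X y) (n y)| := by
            rw [inner_sub_left, htan y hy, sub_zero]
        _ ≤ ‖X x - X y‖ * ‖n y‖ := abs_real_inner_le_norm _ _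
        _ = dist (X x) (X y) := by rw [hn y hy, mul_one, dist_eq_norm]
        _ ≤ L * dist x y := hX.dist_le_mul x y
        _ ≤ L * ε := by rw [← hyd]; gcongr
    have hLε : (0 : ℝ) ≤ L * ε := (abs_nonneg _).trans hinner
    by_cases hd : DifferentiableAt ℝ (fun t : ℝ => min ε (δ (x + t • X x))) 0
    swap
    · rw [deriv_zero_of_not_differentiableAt hd, abs_zero]; exact hLε
    set φ : ℝ → ℝ := fun t => inner ℝ (y - (x + t • X x)) (n y) with hφ
    have hφd : HasDerivAt φ (-inner ℝ (X x) (n y)) 0 := by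
      have h1 : HasDerivAt (fun t : ℝ => inner ℝ (y - x) (n y) - t * inner ℝ (X x) (n y))
          (-inner ℝ (X x) (n y)) 0 := by
        simpa using ((hasDerivAt_id (0 : ℝ)).mul_const (inner ℝ (X x) (n y))).const_sub
          (inner ℝ (y - x) (n y))
      refine h1.congr_of_eventuallyEq (Eventually.of_forall fun t => ?_)
      simp only [hφ]
      rw [← sub_sub, inner_sub_left _ (t • X x), real_inner_smul_left]
    have hmin : IsLocalMin (fun t => φ t - min ε (δ (x + t • X x))) 0 := by
      have hev : ∀ᶠ t : ℝ in 𝓝 0, x + t • X x ∈ Ω :=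
        hline.eventually_mem (hΩ.mem_nhds (by simpa using hxΩ))
      filter_upwards [hev] with t ht
      have h0 : φ 0 - min ε (δ (x + (0 : ℝ) • X x)) ≤ 0 := by
        have h2 : φ 0 ≤ δ x := by
          calc φ 0 = inner ℝ (y - x) (n y) := by simp [hφ]
            _ ≤ ‖y - x‖ * ‖n y‖ := real_inner_le_norm _ _
            _ = δ x := by rw [hn y hy, mul_one, ← dist_eq_norm, dist_comm]; exact hyd.symm
        rw [zero_smul, add_zero, min_eq_right hxε.le]
        linarith
      have h1 : min ε (δ (x + t • X x)) ≤ φ t := (min_le_right _ _).trans (hle ht)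
      linarith
    have hz := hmin.hasDerivAt_eq_zero (hφd.sub hd.hasDerivAt)
    have : deriv (fun t : ℝ => min ε (δ (x + t • X x))) 0 = -inner ℝ (X x) (n y) := by
      linarith
    rw [this, abs_neg]
    exact hinner
  · rw [indicator_of_notMem hx]
    have hzero : deriv (fun t : ℝ => min ε (δ (x + t • X x))) 0 = 0 := by
      by_cases hxΩ : x ∈ Ω
      · have hxε : ε ≤ δ x := not_lt.1 fun h => hx ⟨hxΩ, h⟩
        refine IsLocalMax.deriv_eq_zero (Eventually.of_forall fun t => ?_)
        simp [hxε]
      · have hx0 : δ x = 0 := Metric.infDist_zero_of_mem hxΩ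
        by_cases hε : 0 ≤ ε
        · refine IsLocalMin.deriv_eq_zero (Eventually.of_forall fun t => ?_)
          simpa [hx0, hε] using Metric.infDist_nonneg
        · have hconst : (fun t : ℝ => min ε (δ (x + t • X x))) = fun _ => ε := by
            funext t
            exact min_eq_left ((not_le.1 hε).le.trans Metric.infDist_nonneg)
          rw [hconst, deriv_const]
    rw [hzero, abs_zero]

end InnerDistance

theorem contDiff_pd {d : ℕ} {f : Ed d → ℝ} (hf : ContDiff ℝ (⊤ : ℕ∞) f) (i : Fin d) :
    ContDiff ℝ (⊤ : ℕ∞) (pd i f) :=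
  (hf.fderiv_right (m := (⊤ : ℕ∞)) le_rfl).clm_apply contDiff_const

theorem contDiff_coord {d : ℕ} {w : Ed d → Ed d} (hw : ContDiff ℝ (⊤ : ℕ∞) w) (i : Fin d) :
    ContDiff ℝ (⊤ : ℕ∞) (fun y => w y i) :=
  (contDiff_euclidean.1 hw) i

theorem contDiff_divg {d : ℕ} {w : Ed d → Ed d} (hw : ContDiff ℝ (⊤ : ℕ∞) w) :
    ContDiff ℝ (⊤ : ℕ∞) (divg w) :=
  ContDiff.sum fun i _ => contDiff_pd (contDiff_coord hw i) i

theorem inner_eq_sum_mul {d : ℕ} (a b : Ed d) : inner ℝ a b = ∑ i, a i * b i := by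
  simp [PiLp.inner_apply, mul_comm]

theorem GoodDomain.ne_univ {d : ℕ} {Ω : Set (Ed d)} {n : Ed d → Ed d}
    (hdom : GoodDomain d Ω n) : Ω ≠ univ := by
  have : NeZero d := ⟨by rcases hdom.dims with h | h <;> omega⟩
  have : NoncompactSpace (Ed d) := NormedSpace.noncompactSpace ℝ _
  rintro rfl
  exact NoncompactSpace.noncompact_univ (hdom.bounded.isCompact_closure.of_isClosed_subset
    isClosed_univ subset_closure)

/-- Testing the divergence of a compactly supported field against a Lipschitz function. -/
theorem integral_divg_mul_eq {d : ℕ} {X : Ed d → Ed d} (hX : ContDiff ℝ (⊤ : ℕ∞) X)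
    (hXc : HasCompactSupport X) {η : Ed d → ℝ} {C : NNReal} (hη : LipschitzWith C η) :
    ∫ x, divg X x * η x = -∫ x, lineDeriv ℝ η x (X x) := by
  have hXi := contDiff_coord hX
  have hXic : ∀ i, HasCompactSupport (fun y => X y i) := fun i =>
    hXc.comp_left (g := fun v : Ed d => v i) rfl
  set e : Fin d → Ed d := fun i => EuclideanSpace.single i 1
  have hpart : ∀ i, ∫ x, lineDeriv ℝ η x (e i) * X x i =
      -∫ x, pd i (fun y => X y i) x * η x := by
    intro i
    obtain ⟨D, hD⟩ := ContDiff.lipschitzWith_of_hasCompactSupport (𝕂 := ℝ) (hXic i) (hXi i)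
      (by simp)
    rw [hη.integral_lineDeriv_mul_eq hD (hXic i) (e i), ← integral_neg]
    refine integral_congr_ae (Eventually.of_forall fun x => ?_)
    have hd : DifferentiableAt ℝ (fun y => X y i) x := ((hXi i).differentiable (by simp)) x
    simp only [hd.lineDeriv_eq_fderiv, map_neg, neg_mul, pd, e]
  have hint1 : ∀ i, Integrable (fun x => lineDeriv ℝ η x (e i) * X x i) := fun i =>
    Integrable.mul_of_top_right
      ((hXi i).continuous.integrable_of_hasCompactSupport (hXic i)) (hη.memLp_lineDeriv (e i))
  have hint2 : ∀ i, Integrable (fun x => pd i (fun y => X y i) x * η x) := fun i => by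
    refine ((contDiff_pd (hXi i) i).continuous.mul hη.continuous).integrable_of_hasCompactSupport
      (HasCompactSupport.mul_right ?_)
    exact (hXic i).fderiv_apply ℝ _
  have hsum : ∀ᵐ x, lineDeriv ℝ η x (X x) = ∑ i, lineDeriv ℝ η x (e i) * X x i := by
    have hXrep : ∀ x, ∑ i, X x i • e i = X x := fun x => by
      have := (EuclideanSpace.basisFun (Fin d) ℝ).sum_repr (X x)
      simpa [e] using this
    filter_upwards [hη.ae_differentiableAt (μ := (volume : Measure (Ed d)))] with x hx
    rw [hx.lineDeriv_eq_fderiv]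
    conv_lhs => rw [← hXrep x]
    rw [map_sum]
    refine Finset.sum_congr rfl fun i _ => ?_
    rw [map_smul, hx.lineDeriv_eq_fderiv, smul_eq_mul, mul_comm]
  rw [integral_congr_ae hsum, integral_finsetSum _ (fun i _ => hint1 i)]
  simp only [hpart, Finset.sum_neg_distrib, neg_neg, divg, Finset.sum_mul]
  rw [integral_finsetSum _ (fun i _ => hint2 i)]

theorem GoodDomain.integral_divg_eq_zero_of_hasCompactSupport {d : ℕ} {Ω : Set (Ed d)}
    {n X : Ed d → Ed d} (hdom : GoodDomain d Ω n) (hX : ContDiff ℝ (⊤ : ℕ∞) X)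
    (hXc : HasCompactSupport X) (htan : ∀ y ∈ frontier Ω, ∑ i, X y i * n y i = 0) :
    ∫ x in Ω, divg X x = 0 := by
  obtain ⟨L, hL⟩ := ContDiff.lipschitzWith_of_hasCompactSupport (𝕂 := ℝ) hXc hX (by simp)
  have hne := hdom.ne_univ
  have hΩm : MeasurableSet Ω := hdom.isOpen.measurableSet
  have hΩfin : volume Ω ≠ ⊤ := hdom.bounded.measure_lt_top.ne
  set δ : Ed d → ℝ := fun z => Metric.infDist z Ωᶜ
  have hδc : Continuous δ := Metric.continuous_infDist_pt _
  have hδpos : ∀ x ∈ Ω, 0 < δ x := fun x hx =>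
    (hdom.isOpen.isClosed_compl.notMem_iff_infDist_pos (nonempty_compl.2 hne)).1
      (by simpa using hx)
  set ε : ℕ → ℝ := fun k => 1 / ((k : ℝ) + 1)
  have hε : ∀ k, 0 < ε k := fun k => by positivity
  have hεlim : Tendsto ε atTop (𝓝 0) := tendsto_one_div_add_atTop_nhds_zero_nat
  set S : ℕ → Set (Ed d) := fun k => {z | z ∈ Ω ∧ δ z < ε k}
  have hSm : ∀ k, MeasurableSet (S k) := fun k =>
    hΩm.inter (hδc.measurable measurableSet_Iio)
  have hdivc : Continuous (divg X) := (contDiff_divg hX).continuous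
  have hdivint : Integrable (divg X) := by
    refine integrable_finsetSum _ fun i _ => ?_
    refine (contDiff_pd (contDiff_coord hX i) i).continuous.integrable_of_hasCompactSupport ?_
    exact HasCompactSupport.fderiv_apply ℝ (hXc.comp_left (g := fun v : Ed d => v i) rfl) _
  have hkey : ∀ k, |∫ x, divg X x * ((ε k)⁻¹ * min (ε k) (δ x))| ≤
      ∫ x, (S k).indicator (fun _ => (L : ℝ)) x := by
    intro k
    have hη : LipschitzWith 1 (fun z => min (ε k) (δ z)) :=
      (Metric.lipschitz_infDist_pt Ωᶜ).const_min (ε k)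
    have h1 : ∫ x, divg X x * ((ε k)⁻¹ * min (ε k) (δ x)) =
        (ε k)⁻¹ * ∫ x, divg X x * min (ε k) (δ x) := by
      rw [← integral_const_mul]
      exact integral_congr_ae (Eventually.of_forall fun x => by ring)
    have h2 : |∫ x, lineDeriv ℝ (fun z => min (ε k) (δ z)) x (X x)| ≤
        ∫ x, (S k).indicator (fun _ => L * ε k) x := by
      refine norm_integral_le_of_norm_le (f := fun x => lineDeriv ℝ (fun z => min (ε k) (δ z)) x
        (X x)) ?_ (Eventually.of_forall fun x => ?_)
      · refine (integrable_indicator_iff (hSm k)).2 (integrableOn_const ?_)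
        exact ((measure_mono fun x hx => hx.1).trans_lt (lt_top_iff_ne_top.2 hΩfin)).ne
      · refine abs_lineDeriv_min_infDist_compl_le hdom.isOpen hne hdom.normal_unit ?_ hL ?_ x
        · intro y hy p hp
          rw [inner_eq_sum_mul]
          simpa using hdom.normal_outward y hy p hp
        · intro y hy
          rw [inner_eq_sum_mul]
          exact htan y hy
    rw [h1, integral_divg_mul_eq hX hXc hη, abs_mul, abs_neg, abs_of_pos (inv_pos.2 (hε k))]
    calc (ε k)⁻¹ * _ ≤ (ε k)⁻¹ * ∫ x, (S k).indicator (fun _ => L * ε k) x :=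
          mul_le_mul_of_nonneg_left h2 (inv_pos.2 (hε k)).le
      _ = ∫ x, (S k).indicator (fun _ => (L : ℝ)) x := by
          rw [← integral_const_mul]
          refine integral_congr_ae (Eventually.of_forall fun x => ?_)
          by_cases hx : x ∈ S k
          · simp only [indicator_of_mem hx]
            field_simp [(hε k).ne']
          · simp only [indicator_of_notMem hx, mul_zero]
  have hlim1 : Tendsto (fun k => ∫ x, divg X x * ((ε k)⁻¹ * min (ε k) (δ x))) atTop
      (𝓝 (∫ x, Ω.indicator (divg X) x)) := by
    refine tendsto_integral_of_dominated_convergence (fun x => ‖divg X x‖)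
      (fun k => ?_) hdivint.norm (fun k => Eventually.of_forall fun x => ?_)
      (Eventually.of_forall fun x => ?_)
    · exact (hdivc.mul (continuous_const.mul (continuous_const.min hδc))).aestronglyMeasurable
    · rw [norm_mul]
      refine mul_le_of_le_one_right (norm_nonneg _) ?_
      have h0 : 0 ≤ min (ε k) (δ x) := le_min (hε k).le Metric.infDist_nonneg
      rw [Real.norm_of_nonneg (mul_nonneg (inv_pos.2 (hε k)).le h0), inv_mul_le_iff₀ (hε k),
        mul_one]
      exact min_le_left _ _
    · by_cases hx : x ∈ Ω
      · rw [indicator_of_mem hx]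
        refine tendsto_const_nhds.congr' ?_
        filter_upwards [hεlim.eventually (gt_mem_nhds (hδpos x hx))] with k hk
        rw [min_eq_left hk.le, inv_mul_cancel₀ (hε k).ne', mul_one]
      · rw [indicator_of_notMem hx]
        have h0 : δ x = 0 := Metric.infDist_zero_of_mem hx
        simp [h0, (hε _).le]
  have hlim2 : Tendsto (fun k => ∫ x, (S k).indicator (fun _ => (L : ℝ)) x) atTop
      (𝓝 (∫ _ : Ed d, (0 : ℝ))) := by
    refine tendsto_integral_of_dominated_convergence (Ω.indicator fun _ => (L : ℝ))
      (fun k => ?_) ?_ (fun k => Eventually.of_forall fun x => ?_)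
      (Eventually.of_forall fun x => ?_)
    · exact (measurable_const.indicator (hSm k)).aestronglyMeasurable
    · exact (integrable_indicator_iff hΩm).2 (integrableOn_const hΩfin)
    · by_cases hx : x ∈ S k
      · rw [indicator_of_mem hx, indicator_of_mem hx.1]
        simp
      · rw [indicator_of_notMem hx, norm_zero]
        exact indicator_nonneg (fun _ _ => L.coe_nonneg) x
    · refine tendsto_const_nhds.congr' ?_
      by_cases hx : x ∈ Ω
      · filter_upwards [hεlim.eventually (gt_mem_nhds (hδpos x hx))] with k hk
        rw [indicator_of_notMem fun h : x ∈ S k => lt_asymm hk h.2]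
      · exact Eventually.of_forall fun k => (indicator_of_notMem (fun h : x ∈ S k => hx h.1) _).symm
  rw [integral_zero] at hlim2
  have h0 := squeeze_zero_norm (fun k => (Real.norm_eq_abs _).trans_le (hkey k)) hlim2
  rw [← integral_indicator hΩm]
  exact tendsto_nhds_unique hlim1 h0

/-- The divergence theorem for a field tangent to the boundary. -/
theorem GoodDomain.integral_divg_eq_zero {d : ℕ} {Ω : Set (Ed d)} {n X : Ed d → Ed d}
    (hdom : GoodDomain d Ω n) (hX : ContDiff ℝ (⊤ : ℕ∞) X)
    (htan : ∀ y ∈ frontier Ω, ∑ i, X y i * n y i = 0) :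
    ∫ x in Ω, divg X x = 0 := by
  obtain ⟨R, hR0, hR⟩ := hdom.bounded.subset_ball_lt 0 (0 : Ed d)
  let ψ : ContDiffBump (0 : Ed d) := ⟨R, R + 1, hR0, by linarith⟩
  have hψ1 : ∀ x ∈ Ω, ψ x = 1 := fun x hx =>
    ψ.one_of_mem_closedBall (Metric.ball_subset_closedBall (hR hx))
  have h := hdom.integral_divg_eq_zero_of_hasCompactSupport (X := fun x => ψ x • X x)
    (ψ.contDiff.smul hX) ψ.hasCompactSupport.smul_right fun y hy => by
      simp only [PiLp.smul_apply, smul_eq_mul, mul_assoc, ← Finset.mul_sum, htan y hy, mul_zero]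
  rw [← h]
  refine setIntegral_congr_fun hdom.isOpen.measurableSet fun x hx => ?_
  refine Finset.sum_congr rfl fun i _ => ?_
  have hev : (fun y => X y i) =ᶠ[𝓝 x] fun y => (ψ y • X y) i := by
    filter_upwards [hdom.isOpen.mem_nhds hx] with y hy
    rw [hψ1 y hy, one_smul]
  simp only [pd, hev.fderiv_eq]

theorem pd_comm {d : ℕ} {f : Ed d → ℝ} (hf : ContDiff ℝ (⊤ : ℕ∞) f) (i j : Fin d) (x : Ed d) :
    pd i (pd j f) x = pd j (pd i f) x := by
  have hd : DifferentiableAt ℝ (fderiv ℝ f) x :=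
    (hf.fderiv_right (m := (⊤ : ℕ∞)) le_rfl).differentiable (by simp) x
  have hsymm : IsSymmSndFDerivAt ℝ f x :=
    hf.contDiffAt.isSymmSndFDerivAt (by
      rw [minSmoothness_of_isRCLikeNormedField]
      exact WithTop.coe_le_coe.2 (le_top : (2 : ℕ∞) ≤ ⊤))
  have h : ∀ a b : Fin d, pd a (pd b f) x =
      fderiv ℝ (fderiv ℝ f) x (EuclideanSpace.single a 1) (EuclideanSpace.single b 1) := by
    intro a b
    change fderiv ℝ (fun y => fderiv ℝ f y (EuclideanSpace.single b 1)) x _ = _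
    rw [fderiv_clm_apply hd (differentiableAt_const _)]
    simp
  rw [h, h, hsymm.eq]

theorem pd_mul {d : ℕ} {f g : Ed d → ℝ} (hf : ContDiff ℝ (⊤ : ℕ∞) f)
    (hg : ContDiff ℝ (⊤ : ℕ∞) g) (i : Fin d) (x : Ed d) :
    pd i (fun y => f y * g y) x = f x * pd i g x + pd i f x * g x := by
  unfold pd
  rw [fderiv_fun_mul (hf.differentiable (by simp) x) (hg.differentiable (by simp) x)]
  simp [mul_comm]

theorem pd_sub {d : ℕ} {f g : Ed d → ℝ} (hf : ContDiff ℝ (⊤ : ℕ∞) f)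
    (hg : ContDiff ℝ (⊤ : ℕ∞) g) (i : Fin d) (x : Ed d) :
    pd i (fun y => f y - g y) x = pd i f x - pd i g x := by
  unfold pd
  rw [fderiv_fun_sub (hf.differentiable (by simp) x) (hg.differentiable (by simp) x)]
  simp

theorem pd_sum {d : ℕ} {ι : Type*} {s : Finset ι} {f : ι → Ed d → ℝ}
    (hf : ∀ k, ContDiff ℝ (⊤ : ℕ∞) (f k)) (i : Fin d) (x : Ed d) :
    pd i (fun y => ∑ k ∈ s, f k y) x = ∑ k ∈ s, pd i (f k) x := by
  unfold pd
  rw [fderiv_fun_sum fun k _ => (hf k).differentiable (by simp) x]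
  simp

theorem contDiff_curlM {d : ℕ} {w : Ed d → Ed d} (hw : ContDiff ℝ (⊤ : ℕ∞) w) (i j : Fin d) :
    ContDiff ℝ (⊤ : ℕ∞) (fun x => curlM w x i j) :=
  (contDiff_pd (contDiff_coord hw j) i).sub (contDiff_pd (contDiff_coord hw i) j)

theorem contDiff_veclap {d : ℕ} {w : Ed d → Ed d} (hw : ContDiff ℝ (⊤ : ℕ∞) w) (j : Fin d) :
    ContDiff ℝ (⊤ : ℕ∞) (fun x => veclap w x j) :=
  ContDiff.sum fun i _ => contDiff_pd (contDiff_pd (contDiff_coord hw j) i) i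

/-- The componentwise Laplacian is `∇ div - curl curl`. -/
theorem veclap_eq {d : ℕ} {w : Ed d → Ed d} (hw : ContDiff ℝ (⊤ : ℕ∞) w) (x : Ed d)
    (j : Fin d) : veclap w x j = pd j (divg w) x - ccurl w x j := by
  have hwi := contDiff_coord hw
  have h1 : pd j (divg w) x = ∑ i, pd i (pd j fun y => w y i) x := by
    unfold divg
    rw [pd_sum fun k => contDiff_pd (hwi k) k]
    exact Finset.sum_congr rfl fun i _ => pd_comm (hwi i) j i x
  rw [h1, veclap, ccurl, ← Finset.sum_sub_distrib]
  refine Finset.sum_congr rfl fun i _ => ?_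
  simp only [curlM]
  rw [pd_sub (contDiff_pd (hwi i) j) (contDiff_pd (hwi j) i)]
  ring

/-- The bilinear Dirichlet density `div u div v + curl u · curl v`. -/
noncomputable def divCurlDensity {d : ℕ} (u v : Ed d → Ed d) (x : Ed d) : ℝ :=
  divg u x * divg v x + (1 / 2) * ∑ i, ∑ j, curlM u x i j * curlM v x i j

theorem contDiff_divCurlDensity {d : ℕ} {u v : Ed d → Ed d} (hu : ContDiff ℝ (⊤ : ℕ∞) u)
    (hv : ContDiff ℝ (⊤ : ℕ∞) v) : ContDiff ℝ (⊤ : ℕ∞) (divCurlDensity u v) :=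
  ((contDiff_divg hu).mul (contDiff_divg hv)).add (contDiff_const.mul
    (ContDiff.sum fun i _ => ContDiff.sum fun j _ =>
      (contDiff_curlM hu i j).mul (contDiff_curlM hv i j)))

/-- The flux `v div u - (curl u)ᵀ v`, whose divergence is `v · Δu + div u div v + curl u · curl v`. -/
noncomputable def greenFlux {d : ℕ} (u v : Ed d → Ed d) (x : Ed d) : Ed d :=
  WithLp.toLp 2 fun j => v x j * divg u x - ∑ i, curlM u x i j * v x i

theorem contDiff_greenFlux {d : ℕ} {u v : Ed d → Ed d} (hu : ContDiff ℝ (⊤ : ℕ∞) u)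
    (hv : ContDiff ℝ (⊤ : ℕ∞) v) : ContDiff ℝ (⊤ : ℕ∞) (greenFlux u v) :=
  contDiff_euclidean.2 fun j => ((contDiff_coord hv j).mul (contDiff_divg hu)).sub
    (ContDiff.sum fun i _ => (contDiff_curlM hu i j).mul (contDiff_coord hv i))

theorem divg_greenFlux {d : ℕ} {u v : Ed d → Ed d} (hu : ContDiff ℝ (⊤ : ℕ∞) u)
    (hv : ContDiff ℝ (⊤ : ℕ∞) v) (x : Ed d) :
    divg (greenFlux u v) x = (∑ j, veclap u x j * v x j) + divCurlDensity u v x := by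
  have hvi := contDiff_coord hv
  have h1 : ∀ j, pd j (fun y => greenFlux u v y j) x =
      v x j * pd j (divg u) x + pd j (fun y => v y j) x * divg u x
        - ∑ i, (curlM u x i j * pd j (fun y => v y i) x
          + pd j (fun y => curlM u y i j) x * v x i) := by
    intro j
    change pd j (fun y => v y j * divg u y - ∑ i, curlM u y i j * v y i) x = _
    rw [pd_sub ((hvi j).mul (contDiff_divg hu))
      (ContDiff.sum fun i _ => (contDiff_curlM hu i j).mul (hvi i)),
      pd_mul (hvi j) (contDiff_divg hu), pd_sum fun i => (contDiff_curlM hu i j).mul (hvi i)]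
    congr 1
    exact Finset.sum_congr rfl fun i _ => pd_mul (contDiff_curlM hu i j) (hvi i) j x
  have h2 : ∑ j, ∑ i, pd j (fun y => curlM u y i j) x * v x i = ∑ j, ccurl u x j * v x j := by
    rw [Finset.sum_comm]
    simp only [ccurl, Finset.sum_mul]
  have h3 : ∑ j, ∑ i, curlM u x i j * pd j (fun y => v y i) x =
      -((1 / 2) * ∑ i, ∑ j, curlM u x i j * curlM v x i j) := by
    have ha : ∑ j, ∑ i, curlM u x i j * pd j (fun y => v y i) x =
        ∑ i, ∑ j, curlM u x i j * pd j (fun y => v y i) x := Finset.sum_comm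
    have hb : ∑ j, ∑ i, curlM u x i j * pd j (fun y => v y i) x =
        -∑ i, ∑ j, curlM u x i j * pd i (fun y => v y j) x := by
      rw [← Finset.sum_neg_distrib]
      refine Finset.sum_congr rfl fun j _ => ?_
      rw [← Finset.sum_neg_distrib]
      refine Finset.sum_congr rfl fun i _ => ?_
      simp only [curlM]
      ring
    have hc : ∑ i, ∑ j, curlM u x i j * curlM v x i j =
        (∑ i, ∑ j, curlM u x i j * pd i (fun y => v y j) x)
          - ∑ i, ∑ j, curlM u x i j * pd j (fun y => v y i) x := by
      simp only [← Finset.sum_sub_distrib, ← mul_sub]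
      rfl
    linarith
  have h4 : ∀ j, veclap u x j * v x j = v x j * pd j (divg u) x - ccurl u x j * v x j := by
    intro j
    rw [veclap_eq hu]
    ring
  unfold divCurlDensity
  rw [divg, Finset.sum_congr rfl fun j _ => h1 j, Finset.sum_congr rfl fun j _ => h4 j]
  simp only [Finset.sum_sub_distrib, Finset.sum_add_distrib]
  rw [h2, h3, ← Finset.sum_mul]
  change _ + divg v x * divg u x - _ = _
  ring

theorem GoodDomain.integrableOn {d : ℕ} {Ω : Set (Ed d)} {n : Ed d → Ed d}
    (hdom : GoodDomain d Ω n) {f : Ed d → ℝ} (hf : Continuous f) : IntegrableOn f Ω :=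
  (hf.continuousOn.integrableOn_compact hdom.bounded.isCompact_closure).mono_set subset_closure

/-- Green's formula for fields with vanishing normal component and vanishing tangential curl. -/
theorem GoodDomain.integral_veclap_mul {d : ℕ} {Ω : Set (Ed d)} {n u v : Ed d → Ed d}
    (hdom : GoodDomain d Ω n) (hu : ContDiff ℝ (⊤ : ℕ∞) u) (hv : ContDiff ℝ (⊤ : ℕ∞) v)
    (hcurl : ∀ x ∈ frontier Ω, ∀ i, ∑ j, curlM u x i j * n x j = 0)
    (hnormal : ∀ x ∈ frontier Ω, ∑ i, v x i * n x i = 0) :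
    ∫ x in Ω, ∑ j, veclap u x j * v x j = -∫ x in Ω, divCurlDensity u v x := by
  have htan : ∀ x ∈ frontier Ω, ∑ j, greenFlux u v x j * n x j = 0 := by
    intro x hx
    have h1 : ∀ j, greenFlux u v x j * n x j =
        divg u x * (v x j * n x j) - ∑ i, v x i * (curlM u x i j * n x j) := by
      intro j
      change (v x j * divg u x - ∑ i, curlM u x i j * v x i) * n x j = _
      rw [sub_mul, Finset.sum_mul]
      congr 1
      · ring
      · exact Finset.sum_congr rfl fun i _ => by ring
    rw [Finset.sum_congr rfl fun j _ => h1 j, Finset.sum_sub_distrib, ← Finset.mul_sum,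
      hnormal x hx, Finset.sum_comm]
    simp only [← Finset.mul_sum, hcurl x hx, mul_zero, Finset.sum_const_zero, sub_zero]
  have h := hdom.integral_divg_eq_zero (contDiff_greenFlux hu hv) htan
  simp only [divg_greenFlux hu hv] at h
  have hc : Continuous fun x => ∑ j, veclap u x j * v x j := continuous_finsetSum _ fun j _ =>
    (contDiff_veclap hu j).continuous.mul (contDiff_coord hv j).continuous
  rw [integral_add (hdom.integrableOn hc)
    (hdom.integrableOn (contDiff_divCurlDensity hu hv).continuous)] at h
  linarith

theorem hasDerivAt_coord {d : ℕ} {f : ℝ → Ed d} {f' : Ed d} {t : ℝ} (hf : HasDerivAt f f' t)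
    (i : Fin d) : HasDerivAt (fun s => f s i) (f' i) t :=
  (EuclideanSpace.proj (𝕜 := ℝ) i).hasFDerivAt.comp_hasDerivAt t hf

theorem contDiff_slice {F : Type*} [NormedAddCommGroup F] [NormedSpace ℝ F] {d : ℕ}
    {u : ℝ → Ed d → F} (hu : ContDiff ℝ (⊤ : ℕ∞) fun p : ℝ × Ed d => u p.1 p.2) (t : ℝ) :
    ContDiff ℝ (⊤ : ℕ∞) (u t) :=
  hu.comp (contDiff_const.prodMk contDiff_id)

theorem hasDerivAt_tder {F : Type*} [NormedAddCommGroup F] [NormedSpace ℝ F] {d : ℕ}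
    {u : ℝ → Ed d → F} (hu : ContDiff ℝ (⊤ : ℕ∞) fun p : ℝ × Ed d => u p.1 p.2) (t : ℝ)
    (x : Ed d) : HasDerivAt (fun s => u s x) (tder u t x) t := by
  have h : ContDiff ℝ (⊤ : ℕ∞) fun s => u s x := hu.comp (contDiff_id.prodMk contDiff_const)
  exact (h.differentiable (by simp) t).hasDerivAt

theorem contDiff_tder {F : Type*} [NormedAddCommGroup F] [NormedSpace ℝ F] {d : ℕ}
    {u : ℝ → Ed d → F} (hu : ContDiff ℝ (⊤ : ℕ∞) fun p : ℝ × Ed d => u p.1 p.2) :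
    ContDiff ℝ (⊤ : ℕ∞) fun p : ℝ × Ed d => tder u p.1 p.2 := by
  have h : (fun p : ℝ × Ed d => tder u p.1 p.2) =
      fun p => fderiv ℝ (fun q : ℝ × Ed d => u q.1 q.2) p (1, 0) := by
    funext p
    have h1 : HasDerivAt (fun s : ℝ => ((s, p.2) : ℝ × Ed d)) (1, 0) p.1 :=
      (hasDerivAt_id p.1).prodMk (hasDerivAt_const p.1 p.2)
    have h2 := (hu.differentiable (by simp) (p.1, p.2)).hasFDerivAt.comp_hasDerivAt p.1 h1
    exact (hasDerivAt_tder hu p.1 p.2).unique h2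
  rw [h]
  exact (hu.fderiv_right (m := (⊤ : ℕ∞)) le_rfl).clm_apply contDiff_const

theorem eq_of_hasDerivAt_eq_zero {f : ℝ → ℝ} {s : Set ℝ} (hs : IsOpen s) (hsc : Convex ℝ s)
    (hf : ∀ x ∈ s, HasDerivAt f 0 x) {x y : ℝ} (hx : x ∈ s) (hy : y ∈ s) : f x = f y :=
  hs.is_const_of_deriv_eq_zero hsc.isPreconnected
    (fun x hx => (hf x hx).differentiableAt.differentiableWithinAt)
    (fun x hx => (hf x hx).deriv) hx hy

/-- Differentiation under the integral sign for smooth integrands on a bounded domain. -/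
theorem GoodDomain.hasDerivAt_integral {d : ℕ} {Ω : Set (Ed d)} {n : Ed d → Ed d}
    (hdom : GoodDomain d Ω n) {F : ℝ → Ed d → ℝ}
    (hF : ContDiff ℝ (⊤ : ℕ∞) fun p : ℝ × Ed d => F p.1 p.2) (t : ℝ) :
    HasDerivAt (fun s => ∫ x in Ω, F s x) (∫ x in Ω, tder F t x) t := by
  have hF' := contDiff_tder hF
  obtain ⟨C, hC⟩ := ((isCompact_closedBall t 1).prod
    hdom.bounded.isCompact_closure).exists_bound_of_continuousOn hF'.continuous.continuousOn
  refine (hasDerivAt_integral_of_dominated_loc_of_deriv_le (bound := fun _ => C)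
    (F := F) (F' := tder F) (Metric.closedBall_mem_nhds t one_pos)
    (Eventually.of_forall fun s => ?_) (hdom.integrableOn (contDiff_slice hF t).continuous)
    (contDiff_slice hF' t).continuous.aestronglyMeasurable ?_ ?_ ?_).2
  · exact (contDiff_slice hF s).continuous.aestronglyMeasurable
  · refine (ae_restrict_iff' hdom.isOpen.measurableSet).2 (Eventually.of_forall ?_)
    exact fun x hx s hs => hC (s, x) ⟨hs, subset_closure hx⟩
  · exact integrableOn_const hdom.bounded.measure_lt_top.ne
  · exact Eventually.of_forall fun x s _ => hasDerivAt_tder hF s x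

theorem GoodDomain.eqOn_zero_of_integral_eq_zero {d : ℕ} {Ω : Set (Ed d)} {n : Ed d → Ed d}
    (hdom : GoodDomain d Ω n) {f : Ed d → ℝ} (hf : Continuous f) (hf0 : ∀ x, 0 ≤ f x)
    (hint : ∫ x in Ω, f x = 0) : ∀ x ∈ Ω, f x = 0 := by
  have h := (integral_eq_zero_iff_of_nonneg hf0 (hdom.integrableOn hf)).1 hint
  exact Measure.eqOn_open_of_ae_eq h hdom.isOpen hf.continuousOn continuousOn_const

/-- The `L²(Ω)` inner product of vector fields. -/
noncomputable def l2Pairing {d : ℕ} (Ω : Set (Ed d)) (u v : Ed d → Ed d) : ℝ :=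
  ∫ x in Ω, ∑ i, u x i * v x i

theorem l2Pairing_comm {d : ℕ} (Ω : Set (Ed d)) (u v : Ed d → Ed d) :
    l2Pairing Ω u v = l2Pairing Ω v u := by
  simp only [l2Pairing, mul_comm]

theorem contDiff_sum_mul {d : ℕ} {E : Type*} [NormedAddCommGroup E] [NormedSpace ℝ E]
    {u v : E → Ed d} (hu : ContDiff ℝ (⊤ : ℕ∞) u) (hv : ContDiff ℝ (⊤ : ℕ∞) v) :
    ContDiff ℝ (⊤ : ℕ∞) fun x => ∑ i, u x i * v x i :=
  ContDiff.sum fun i _ => (contDiff_euclidean.1 hu i).mul (contDiff_euclidean.1 hv i)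

theorem l2Pairing_self_nonneg {d : ℕ} (Ω : Set (Ed d)) (u : Ed d → Ed d) :
    0 ≤ l2Pairing Ω u u :=
  integral_nonneg fun _ => Finset.sum_nonneg fun _ _ => mul_self_nonneg _

theorem GoodDomain.eqOn_zero_of_l2Pairing_self {d : ℕ} {Ω : Set (Ed d)} {n u : Ed d → Ed d}
    (hdom : GoodDomain d Ω n) (hu : ContDiff ℝ (⊤ : ℕ∞) u) (h : l2Pairing Ω u u = 0) :
    ∀ x ∈ Ω, u x = 0 := by
  intro x hx
  have h0 := hdom.eqOn_zero_of_integral_eq_zero (contDiff_sum_mul hu hu).continuous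
    (fun y => Finset.sum_nonneg fun i _ => mul_self_nonneg _) h x hx
  ext i
  simpa using (Finset.sum_eq_zero_iff_of_nonneg fun i _ => mul_self_nonneg _).1 h0 i
    (Finset.mem_univ i)

theorem GoodDomain.abs_l2Pairing_le {d : ℕ} {Ω : Set (Ed d)} {n u v : Ed d → Ed d}
    (hdom : GoodDomain d Ω n) (hu : ContDiff ℝ (⊤ : ℕ∞) u) (hv : ContDiff ℝ (⊤ : ℕ∞) v) :
    |l2Pairing Ω u v| ≤ l2Pairing Ω u u + l2Pairing Ω v v := by
  have hiu := hdom.integrableOn (contDiff_sum_mul hu hu).continuous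
  have hiv := hdom.integrableOn (contDiff_sum_mul hv hv).continuous
  unfold l2Pairing
  rw [← integral_add hiu hiv]
  refine norm_integral_le_of_norm_le (f := fun x => ∑ i, u x i * v x i) (hiu.add hiv)
    (Eventually.of_forall fun x => ?_)
  simp only [Real.norm_eq_abs]
  rw [← Finset.sum_add_distrib]
  refine (Finset.abs_sum_le_sum_abs _ _).trans (Finset.sum_le_sum fun i _ => ?_)
  rw [abs_le]
  constructor <;> nlinarith [sq_nonneg (u x i - v x i), sq_nonneg (u x i + v x i)]

/-- Product rule for the `L²` pairing of two fields moving along affine time paths. -/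
theorem GoodDomain.hasDerivAt_l2Pairing {d : ℕ} {Ω : Set (Ed d)} {n : Ed d → Ed d}
    (hdom : GoodDomain d Ω n) {u v : ℝ → Ed d → Ed d}
    (hu : ContDiff ℝ (⊤ : ℕ∞) fun p : ℝ × Ed d => u p.1 p.2)
    (hv : ContDiff ℝ (⊤ : ℕ∞) fun p : ℝ × Ed d => v p.1 p.2) (a b p q t : ℝ) :
    HasDerivAt (fun s => l2Pairing Ω (u (a + p * s)) (v (b + q * s)))
      (p * l2Pairing Ω (tder u (a + p * t)) (v (b + q * t))
        + q * l2Pairing Ω (u (a + p * t)) (tder v (b + q * t))) t := by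
  have hF : ContDiff ℝ (⊤ : ℕ∞) fun z : ℝ × Ed d =>
      ∑ i, u (a + p * z.1) z.2 i * v (b + q * z.1) z.2 i :=
    contDiff_sum_mul
      (hu.comp ((contDiff_const.add (contDiff_const.mul contDiff_fst)).prodMk contDiff_snd))
      (hv.comp ((contDiff_const.add (contDiff_const.mul contDiff_fst)).prodMk contDiff_snd))
  have h := hdom.hasDerivAt_integral (F := fun s x => ∑ i, u (a + p * s) x i * v (b + q * s) x i)
    hF t
  refine h.congr_deriv ?_
  have hline : ∀ {w : ℝ → Ed d → Ed d},
      (ContDiff ℝ (⊤ : ℕ∞) fun z : ℝ × Ed d => w z.1 z.2) → ∀ (a p : ℝ) x i,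
      HasDerivAt (fun s => w (a + p * s) x i) (p * tder w (a + p * t) x i) t := by
    intro w hw a p x i
    have h1 : HasDerivAt (fun s => a + p * s) p t := by
      simpa using ((hasDerivAt_id t).const_mul p).const_add a
    have h2 := (hasDerivAt_tder hw (a + p * t) x).scomp t h1
    simpa using hasDerivAt_coord h2 i
  have hpt : ∀ x, tder (fun s x => ∑ i, u (a + p * s) x i * v (b + q * s) x i) t x =
      p * (∑ i, tder u (a + p * t) x i * v (b + q * t) x i)
        + q * ∑ i, u (a + p * t) x i * tder v (b + q * t) x i := by
    intro x
    rw [Finset.mul_sum, Finset.mul_sum, ← Finset.sum_add_distrib]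
    refine HasDerivAt.deriv ?_
    refine (HasDerivAt.fun_sum fun i _ => (hline hu a p x i).mul (hline hv b q x i)).congr_deriv ?_
    exact Finset.sum_congr rfl fun i _ => by ring
  simp only [hpt, l2Pairing]
  rw [integral_add, integral_const_mul, integral_const_mul]
  · exact (hdom.integrableOn (contDiff_sum_mul (contDiff_slice (contDiff_tder hu) _)
      (contDiff_slice hv _)).continuous).const_mul p
  · exact (hdom.integrableOn (contDiff_sum_mul (contDiff_slice hu _)
      (contDiff_slice (contDiff_tder hv) _)).continuous).const_mul q

section WaveSystem

variable {d : ℕ} {Ω : Set (Ed d)} {n : Ed d → Ed d} {μ : ℝ} {γ : ℝ → Ed d → Ed d}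

/-- Testing the wave equation at time `s` with the solution at time `t`. -/
theorem l2Pairing_tder_tder (hdom : GoodDomain d Ω n)
    (hγs : ContDiff ℝ (⊤ : ℕ∞) (fun p : ℝ × Ed d => γ p.1 p.2))
    (hwave : ∀ t : ℝ, 0 < t → ∀ x ∈ Ω, ∀ j : Fin d,
      tder (tder γ) t x j - μ * veclap (γ t) x j = 0)
    (hbc1 : ∀ t : ℝ, 0 < t → ∀ x ∈ frontier Ω, ∑ i, γ t x i * n x i = 0)
    (hbc2 : ∀ t : ℝ, 0 < t → ∀ x ∈ frontier Ω, ∀ i : Fin d,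
      ∑ j, curlM (γ t) x i j * n x j = 0) {s t : ℝ} (hs : 0 < s) (ht : 0 < t) :
    l2Pairing Ω (tder (tder γ) s) (γ t) = -(μ * ∫ x in Ω, divCurlDensity (γ s) (γ t) x) := by
  have h : l2Pairing Ω (tder (tder γ) s) (γ t) =
      ∫ x in Ω, μ * ∑ j, veclap (γ s) x j * γ t x j := by
    refine setIntegral_congr_fun hdom.isOpen.measurableSet fun x hx => ?_
    simp only [Finset.mul_sum]
    exact Finset.sum_congr rfl fun j _ => by rw [sub_eq_zero.1 (hwave s hs x hx j), mul_assoc]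
  rw [h, integral_const_mul, hdom.integral_veclap_mul (contDiff_slice hγs s)
    (contDiff_slice hγs t) (hbc2 s hs) (hbc1 t ht), mul_neg]

theorem divCurlDensity_comm (u v : Ed d → Ed d) (x : Ed d) :
    divCurlDensity u v x = divCurlDensity v u x := by
  simp only [divCurlDensity, mul_comm]

theorem divCurlDensity_self_nonneg (u : Ed d → Ed d) (x : Ed d) : 0 ≤ divCurlDensity u u x :=
  add_nonneg (mul_self_nonneg _) (mul_nonneg (by norm_num)
    (Finset.sum_nonneg fun _ _ => Finset.sum_nonneg fun _ _ => mul_self_nonneg _))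

/-- If a solution tends to zero in `L²`, its velocity vanishes at all positive times. -/
theorem tder_eq_zero_of_tendsto (hdom : GoodDomain d Ω n) (hμ : 0 < μ)
    (hγs : ContDiff ℝ (⊤ : ℕ∞) (fun p : ℝ × Ed d => γ p.1 p.2))
    (hwave : ∀ t : ℝ, 0 < t → ∀ x ∈ Ω, ∀ j : Fin d,
      tder (tder γ) t x j - μ * veclap (γ t) x j = 0)
    (hbc1 : ∀ t : ℝ, 0 < t → ∀ x ∈ frontier Ω, ∑ i, γ t x i * n x i = 0)
    (hbc2 : ∀ t : ℝ, 0 < t → ∀ x ∈ frontier Ω, ∀ i : Fin d,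
      ∑ j, curlM (γ t) x i j * n x j = 0)
    (hlim : Tendsto (fun t => l2Pairing Ω (γ t) (γ t)) atTop (𝓝 0)) {t : ℝ} (ht : 0 < t) :
    ∀ x ∈ Ω, tder γ t x = 0 := by
  set G := tder γ with hG
  have hGs := contDiff_tder hγs
  have htest := fun {s t : ℝ} (hs : 0 < s) (ht : 0 < t) =>
    l2Pairing_tder_tder hdom hγs hwave hbc1 hbc2 hs ht
  have hsymm : ∀ {s t : ℝ}, 0 < s → 0 < t →
      l2Pairing Ω (tder G s) (γ t) = l2Pairing Ω (γ s) (tder G t) := by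
    intro s t hs ht
    rw [htest hs ht, l2Pairing_comm, htest ht hs]
    simp only [divCurlDensity_comm]
  set P : ℝ → ℝ → ℝ := fun t r => l2Pairing Ω (γ (t + -1 * r)) (γ (t + 1 * r))
  set W : ℝ → ℝ → ℝ := fun t r => -1 * l2Pairing Ω (G (t + -1 * r)) (γ (t + 1 * r))
    + 1 * l2Pairing Ω (γ (t + -1 * r)) (G (t + 1 * r)) with hW
  have hPr : ∀ t r, HasDerivAt (P t) (W t r) r := fun t r =>
    hdom.hasDerivAt_l2Pairing hγs hγs t t (-1) 1 r
  have hWt : ∀ r t, |r| < t → HasDerivAt (fun s => W s r) 0 t := by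
    intro r t hrt
    obtain ⟨h1, h2⟩ := abs_lt.1 hrt
    have ha := hdom.hasDerivAt_l2Pairing hGs hγs (-1 * r) (1 * r) 1 1 t
    have hb := hdom.hasDerivAt_l2Pairing hγs hGs (-1 * r) (1 * r) 1 1 t
    have hc := (ha.const_mul (-1)).add (hb.const_mul 1)
    have hs := hsymm (s := -1 * r + 1 * t) (t := 1 * r + 1 * t) (by linarith) (by linarith)
    refine (hc.congr_deriv ?_).congr_of_eventuallyEq (Eventually.of_forall fun s => ?_)
    · linarith
    · simp only [hW, hG, Pi.add_apply, one_mul, add_comm]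
  have hWconst : ∀ {r s t : ℝ}, |r| < s → |r| < t → W s r = W t r := fun {r s t} hs ht =>
    eq_of_hasDerivAt_eq_zero isOpen_Ioi (convex_Ioi |r|) (hWt r) hs ht
  have hPdiff : ∀ {r s t : ℝ}, |r| < s → |r| < t → P s r - P t r = P s 0 - P t 0 := by
    intro r s t hs ht
    have hder : ∀ ρ ∈ Ioo (-min s t) (min s t), HasDerivAt (fun ρ => P s ρ - P t ρ) 0 ρ := by
      intro ρ hρ
      have hρ' := lt_min_iff.1 (abs_lt.2 hρ)
      refine ((hPr s ρ).sub (hPr t ρ)).congr_deriv ?_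
      rw [hWconst hρ'.1 hρ'.2, sub_self]
    have hr : |r| < min s t := lt_min hs ht
    exact eq_of_hasDerivAt_eq_zero isOpen_Ioo (convex_Ioo _ _) hder (abs_lt.1 hr)
      (abs_lt.1 (by simpa using (abs_nonneg r).trans_lt hr))
  have hPlim : ∀ r, Tendsto (fun t => P t r) atTop (𝓝 0) := by
    intro r
    have h1 : Tendsto (fun t => l2Pairing Ω (γ (t + -1 * r)) (γ (t + -1 * r))
        + l2Pairing Ω (γ (t + 1 * r)) (γ (t + 1 * r))) atTop (𝓝 (0 + 0)) :=
      (hlim.comp (tendsto_atTop_add_const_right _ _ tendsto_id)).add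
        (hlim.comp (tendsto_atTop_add_const_right _ _ tendsto_id))
    rw [add_zero] at h1
    exact squeeze_zero_norm (fun s =>
      hdom.abs_l2Pairing_le (contDiff_slice hγs _) (contDiff_slice hγs _)) h1
  have hPconst : ∀ {r s : ℝ}, |r| < s → P s r = P s 0 := by
    intro r s hs
    have h1 : Tendsto (fun t => P s r - P t r) atTop (𝓝 (P s r - 0)) :=
      tendsto_const_nhds.sub (hPlim r)
    have h2 : Tendsto (fun t => P s 0 - P t 0) atTop (𝓝 (P s 0 - 0)) :=
      tendsto_const_nhds.sub (hPlim 0)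
    have h3 : (fun t => P s 0 - P t 0) =ᶠ[atTop] fun t => P s r - P t r := by
      filter_upwards [eventually_gt_atTop |r|] with t ht
      exact (hPdiff hs ht).symm
    simpa using tendsto_nhds_unique h1 (h2.congr' h3)
  have hball : ∀ {r : ℝ}, |r| < t → ∀ᶠ ρ in 𝓝 r, |ρ| < t := fun {r} hr =>
    continuous_abs.continuousAt.eventually (gt_mem_nhds hr)
  have hW0 : ∀ r, |r| < t → W t r = 0 := by
    intro r hr
    have h1 : P t =ᶠ[𝓝 r] fun _ => P t 0 := by
      filter_upwards [hball hr] with ρ hρ using hPconst hρ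
    exact (hPr t r).unique ((hasDerivAt_const r (P t 0)).congr_of_eventuallyEq h1)
  have hWr : HasDerivAt (W t) 0 0 := by
    refine (hasDerivAt_const 0 (0 : ℝ)).congr_of_eventuallyEq ?_
    filter_upwards [hball (r := 0) (by simpa using ht)] with ρ hρ using hW0 ρ hρ
  have hWr' := ((hdom.hasDerivAt_l2Pairing hGs hγs t t (-1) 1 0).const_mul (-1)).add
    ((hdom.hasDerivAt_l2Pairing hγs hGs t t (-1) 1 0).const_mul 1)
  have hid := hWr'.unique hWr
  simp only [mul_zero, add_zero] at hid
  have hval := htest ht ht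
  have hsy := hsymm ht ht
  have hnn : 0 ≤ μ * ∫ x in Ω, divCurlDensity (γ t) (γ t) x :=
    mul_nonneg hμ.le (integral_nonneg fun x => divCurlDensity_self_nonneg _ x)
  have hGG := l2Pairing_self_nonneg Ω (G t)
  refine hdom.eqOn_zero_of_l2Pairing_self (contDiff_slice hGs t) ?_
  change -1 * (-1 * l2Pairing Ω (tder G t) (γ t) + 1 * l2Pairing Ω (G t) (G t)) +
    1 * (-1 * l2Pairing Ω (G t) (G t) + 1 * l2Pairing Ω (γ t) (tder G t)) = 0 at hid
  linarith

theorem eq_zero_of_tendsto (hdom : GoodDomain d Ω n) (hμ : 0 < μ)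
    (hγs : ContDiff ℝ (⊤ : ℕ∞) (fun p : ℝ × Ed d => γ p.1 p.2))
    (hwave : ∀ t : ℝ, 0 < t → ∀ x ∈ Ω, ∀ j : Fin d,
      tder (tder γ) t x j - μ * veclap (γ t) x j = 0)
    (hbc1 : ∀ t : ℝ, 0 < t → ∀ x ∈ frontier Ω, ∑ i, γ t x i * n x i = 0)
    (hbc2 : ∀ t : ℝ, 0 < t → ∀ x ∈ frontier Ω, ∀ i : Fin d,
      ∑ j, curlM (γ t) x i j * n x j = 0)
    (hlim : Tendsto (fun t => l2Pairing Ω (γ t) (γ t)) atTop (𝓝 0)) {t : ℝ} (ht : 0 ≤ t)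
    {x : Ed d} (hx : x ∈ Ω) : γ t x = 0 := by
  have hconst : ∀ {s t : ℝ}, 0 < s → 0 < t → ∀ y ∈ Ω, γ s y = γ t y := by
    intro s t hs ht y hy
    ext i
    refine eq_of_hasDerivAt_eq_zero (f := fun s => γ s y i) isOpen_Ioi (convex_Ioi 0)
      (fun r hr => ?_) hs ht
    have h := hasDerivAt_coord (hasDerivAt_tder hγs r y) i
    rwa [tder_eq_zero_of_tendsto hdom hμ hγs hwave hbc1 hbc2 hlim hr y hy] at h
  have hpos : ∀ t, 0 < t → γ t x = 0 := by
    intro t ht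
    refine hdom.eqOn_zero_of_l2Pairing_self (contDiff_slice hγs t) ?_ x hx
    refine tendsto_nhds_unique (tendsto_const_nhds.congr' ?_) hlim
    filter_upwards [eventually_gt_atTop 0] with s hs
    refine setIntegral_congr_fun hdom.isOpen.measurableSet fun y hy => ?_
    simp only [hconst ht hs y hy]
  rcases ht.eq_or_lt with rfl | ht
  · have hc : Continuous fun s => γ s x :=
      hγs.continuous.comp (continuous_id.prodMk continuous_const)
    have h1 : Tendsto (fun s => γ s x) (𝓝[>] 0) (𝓝 (γ 0 x)) :=
      hc.continuousAt.tendsto.mono_left nhdsWithin_le_nhds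
    refine tendsto_nhds_unique h1 (tendsto_const_nhds.congr' ?_)
    filter_upwards [self_mem_nhdsWithin] with s hs using (hpos s hs).symm
  · exact hpos t ht

end WaveSystem

/-- a solution of the homogeneous wave system with the boundary
conditions `γ·n = 0`, `𝒩γ = 0` converges to `0` in `L²(Ω)` iff it vanishes
identically. -/
theorem wave_tendsto_zero_iff {d : ℕ} {Ω : Set (Ed d)} {n : Ed d → Ed d} {μ : ℝ}
    (hdom : GoodDomain d Ω n) (hμ : 0 < μ) (γ : ℝ → Ed d → Ed d)
    (hγs : ContDiff ℝ (⊤ : ℕ∞) (fun p : ℝ × Ed d => γ p.1 p.2))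
    (hwave : ∀ t : ℝ, 0 < t → ∀ x ∈ Ω, ∀ j : Fin d,
      tder (tder γ) t x j - μ * veclap (γ t) x j = 0)
    (hbc1 : ∀ t : ℝ, 0 < t → ∀ x ∈ frontier Ω, ∑ i, γ t x i * n x i = 0)
    (hbc2 : ∀ t : ℝ, 0 < t → ∀ x ∈ frontier Ω, ∀ i : Fin d,
      ∑ j, curlM (γ t) x i j * n x j = 0) :
    Filter.Tendsto (fun t => Real.sqrt (∫ x in Ω, ∑ i, (γ t x i) ^ 2))
        Filter.atTop (nhds 0)
      ↔ ∀ t : ℝ, 0 ≤ t → ∀ x ∈ Ω, γ t x = 0 := by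
  have hsq : ∀ t, ∫ x in Ω, ∑ i, (γ t x i) ^ 2 = l2Pairing Ω (γ t) (γ t) := fun t => by
    simp only [l2Pairing, sq]
  simp only [hsq]
  constructor
  · intro h t ht x hx
    refine eq_zero_of_tendsto hdom hμ hγs hwave hbc1 hbc2 ?_ ht hx
    have h2 := h.pow 2
    simpa only [Real.sq_sqrt (l2Pairing_self_nonneg Ω _), ne_eq, OfNat.ofNat_ne_zero,
      not_false_eq_true, zero_pow] using h2
  · intro h
    refine tendsto_const_nhds.congr' ?_
    filter_upwards [eventually_ge_atTop 0] with t ht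
    have h0 : l2Pairing Ω (γ t) (γ t) = 0 :=
      setIntegral_eq_zero_of_forall_eq_zero fun x hx => by simp [h t ht x hx]
    rw [h0, Real.sqrt_zero]
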